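/- arXiv:2008.03463 — 2 statements merged into one kernel-verified Lean document; each statement's English description precedes it below -/
import Mathlib

section
/- Let Σ_{𝓡⁻} be the topological Markov shift whose transition matrix satisfies A(i, i+1) = A(i, 1) = 1 for every i ≥ 1 and all other entries are 0, and let x̄ := (1, 2, 3, …) ∈ Σ_{𝓡⁻}. Then for every measurable potential φ : Σ_{𝓡⁻} → ℝ, the Dirac measure δ_{x̄} is a φ-DLR probability measure. -/
open MeasureTheory Filter Topology ENNReal

namespace CMS

/-- A sequence is admissible for the transition matrix `A`. -/
def IsAdm (A : ℕ → ℕ → Bool) (u : ℕ → ℕ) : Prop := ∀ i, A (u i) (u (i + 1)) = true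

/-- The one-sided countable topological Markov shift. -/
abbrev Space (A : ℕ → ℕ → Bool) := {u : ℕ → ℕ // IsAdm A u}

/-- The transition matrix has no row and no column identically zero. -/
def NoDegenerate (A : ℕ → ℕ → Bool) : Prop :=
  (∀ i, ∃ j, A i j = true) ∧ (∀ j, ∃ i, A i j = true)

/-- The shift map. -/
def shift {A : ℕ → ℕ → Bool} (x : Space A) : Space A :=
  ⟨fun i => x.1 (i + 1), fun i => x.2 (i + 1)⟩

/-- Birkhoff (ergodic) sum `φ_n`. -/
noncomputable def birkhoff {A : ℕ → ℕ → Bool} (φ : Space A → ℝ) (n : ℕ) (x : Space A) : ℝ :=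
  ∑ i ∈ Finset.range n, φ (shift^[i] x)

/-- The cylinder set determined by a word. -/
def cyl (A : ℕ → ℕ → Bool) (w : List ℕ) : Set (Space A) :=
  {x | ∀ i : Fin w.length, x.1 i = w.get i}

/-- Concatenation of a finite word with a sequence. -/
def concatSeq (w : List ℕ) (u : ℕ → ℕ) : ℕ → ℕ :=
  fun i => if h : i < w.length then w.get ⟨i, h⟩ else u (i - w.length)

/-- Prepending a single symbol to a sequence. -/
def prependSeq (a : ℕ) (u : ℕ → ℕ) : ℕ → ℕ := fun i => Nat.casesOn i a u

/-- The set of points to which the symbol `a` may be prepended. -/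
def admits (A : ℕ → ℕ → Bool) (a : ℕ) : Set (Space A) := {x | A a (x.1 0) = true}

/-- Prepending a symbol to a point of the shift space (identity if not admissible). -/
noncomputable def prep (A : ℕ → ℕ → Bool) (a : ℕ) (x : Space A) : Space A :=
  if h : A a (x.1 0) = true then
    ⟨prependSeq a x.1, by
      intro i
      cases i with
      | zero => exact h
      | succ j => exact x.2 j⟩
  else x

/-- The measure `ν ⊚ σ`, `ν⊚σ(E) = Σ_a ν(σ(E ∩ [a]))`. -/
noncomputable def circ (A : ℕ → ℕ → Bool) (ν : Measure (Space A)) : Measure (Space A) :=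
  Measure.sum fun a : ℕ => (ν.restrict (admits A a)).map (prep A a)

/-- `ν` is `(φ, l)`-conformal: `dν/d(ν⊚σ) = l⁻¹ e^φ`. -/
def Conformal (A : ℕ → ℕ → Bool) (φ : Space A → ℝ) (l : ℝ) (ν : Measure (Space A)) : Prop :=
  ∀ E : Set (Space A), MeasurableSet E →
    ν E = ∫⁻ x in E, ENNReal.ofReal (l⁻¹ * Real.exp (φ x)) ∂(circ A ν)

/-- The Ruelle transfer operator. -/
noncomputable def ruelle (A : ℕ → ℕ → Bool) (φ f : Space A → ℝ) (x : Space A) : ℝ :=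
  ∑' a : ℕ, if A a (x.1 0) = true then Real.exp (φ (prep A a x)) * f (prep A a x) else 0

/-- The Ruelle operator applied to the constant function 1, valued in `ℝ≥0∞`. -/
noncomputable def ruelleOne (A : ℕ → ℕ → Bool) (φ : Space A → ℝ) (x : Space A) : ℝ≥0∞ :=
  ∑' a : ℕ, if A a (x.1 0) = true then ENNReal.ofReal (Real.exp (φ (prep A a x))) else 0

/-- `L*_φ ν = l ν` : the dual eigenmeasure equation. -/
def DualEigen (A : ℕ → ℕ → Bool) (φ : Space A → ℝ) (l : ℝ) (ν : Measure (Space A)) : Prop :=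
  ∀ f : Space A → ℝ, Integrable f ν →
    ∫ x, ruelle A φ f x ∂ν = l * ∫ x, f x ∂ν

/-- The sub-σ-algebra `σ^{-n} 𝓑`. -/
def shiftSigma (A : ℕ → ℕ → Bool) (n : ℕ) : MeasurableSpace (Space A) :=
  MeasurableSpace.comap (shift^[n]) inferInstance

/-- A sub-σ-algebra `m` is compatible with `ν`: the restriction of `ν` to `m` is σ-finite. -/
def Compatible (A : ℕ → ℕ → Bool) (ν : Measure (Space A))
    (m : MeasurableSpace (Space A)) : Prop :=
  ∃ s : ℕ → Set (Space A), (∀ k, MeasurableSet[m] (s k)) ∧ (∀ k, ν (s k) ≠ ⊤) ∧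
    (⋃ k, s k) = Set.univ

open Classical in
/-- Numerator of the DLR kernel: `e^{φ_n(w σ^n x)} 1{w σ^n x ∈ Σ_A}`. -/
noncomputable def dlrNum (A : ℕ → ℕ → Bool) (φ : Space A → ℝ) (w : List ℕ)
    (x : Space A) : ℝ :=
  if h : IsAdm A (concatSeq w ((shift^[w.length] x).1)) then
    Real.exp (birkhoff φ w.length (⟨concatSeq w ((shift^[w.length] x).1), h⟩ : Space A))
  else 0

/-- Denominator of the DLR kernel: `Σ_{y : σ^n y = σ^n x} e^{φ_n(y)}`. -/
noncomputable def dlrDen (A : ℕ → ℕ → Bool) (φ : Space A → ℝ) (n : ℕ) (x : Space A) : ℝ :=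
  ∑' y : {y : Space A // shift^[n] y = shift^[n] x}, Real.exp (birkhoff φ n y.1)

/-- `ν` is a `φ`-DLR measure. -/
def IsDLR (A : ℕ → ℕ → Bool) (φ : Space A → ℝ) (ν : Measure (Space A)) : Prop :=
  ∀ n : ℕ, 1 ≤ n →
    Compatible A ν (shiftSigma A n) ∧
    ∀ w : List ℕ, w.length = n →
      (ν[Set.indicator (cyl A w) (fun _ => (1 : ℝ))|shiftSigma A n])
        =ᵐ[ν] fun x => dlrNum A φ w x / dlrDen A φ n x

/-- `ν` is non-singular: `ν ∘ σ⁻¹ ∼ ν`. -/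
def NonSingular (A : ℕ → ℕ → Bool) (ν : Measure (Space A)) : Prop :=
  ν.map shift ≪ ν ∧ ν ≪ ν.map shift

/-- Conservative non-singular measure. -/
def Conservative (A : ℕ → ℕ → Bool) (ν : Measure (Space A)) : Prop :=
  NonSingular A ν ∧
    ∀ W : Set (Space A), MeasurableSet W →
      (∀ i j : ℕ, i ≠ j → ν ((shift^[i] ⁻¹' W) ∩ (shift^[j] ⁻¹' W)) = 0) → ν W = 0

/-- The `n`-th variation `Var_n φ`, valued in `ℝ≥0∞`. -/
noncomputable def varn (A : ℕ → ℕ → Bool) (φ : Space A → ℝ) (n : ℕ) : ℝ≥0∞ :=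
  ⨆ (x : Space A) (y : Space A) (_ : ∀ i, i < n → x.1 i = y.1 i),
    ENNReal.ofReal |φ x - φ y|

noncomputable def waltersBound (A : ℕ → ℕ → Bool) (φ : Space A → ℝ) (k : ℕ) : ℝ≥0∞ :=
  ⨆ (n : ℕ) (_ : 1 ≤ n), varn A (birkhoff φ n) (n + k)

/-- The Walters condition. -/
def Walters (A : ℕ → ℕ → Bool) (φ : Space A → ℝ) : Prop :=
  (∀ k, 1 ≤ k → waltersBound A φ k ≠ ⊤) ∧
  Tendsto (waltersBound A φ) atTop (nhds 0)

/-- `φ` is weakly Hölder continuous. -/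
def WeaklyHolder (A : ℕ → ℕ → Bool) (φ : Space A → ℝ) : Prop :=
  ∃ H θ : ℝ, 0 < H ∧ θ ∈ Set.Ioo (0 : ℝ) 1 ∧
    ∀ n : ℕ, 2 ≤ n → varn A φ n ≤ ENNReal.ofReal (H * θ ^ n)

/-- The partition function `Z_n(φ, a)`, valued in `ℝ≥0∞`. -/
noncomputable def Zn (A : ℕ → ℕ → Bool) (φ : Space A → ℝ) (n a : ℕ) : ℝ≥0∞ :=
  ∑' x : {x : Space A // shift^[n] x = x ∧ x.1 0 = a},
    ENNReal.ofReal (Real.exp (birkhoff φ n x.1))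

/-- The partition function `Z*_n(φ, a)` over periodic points whose first return to `[a]` is `n`. -/
noncomputable def Znstar (A : ℕ → ℕ → Bool) (φ : Space A → ℝ) (n a : ℕ) : ℝ≥0∞ :=
  ∑' x : {x : Space A // shift^[n] x = x ∧ x.1 0 = a ∧
      ∀ k, 0 < k → k < n → (shift^[k] x).1 0 ≠ a},
    ENNReal.ofReal (Real.exp (birkhoff φ n x.1))

/-- `P` is the (finite) Gurevich pressure of `φ`. -/
def HasGurevich (A : ℕ → ℕ → Bool) (φ : Space A → ℝ) (P : ℝ) : Prop :=
  ∀ a : ℕ, (cyl A [a]).Nonempty →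
    (∀ n, 1 ≤ n → Zn A φ n a ≠ ⊤) ∧
    Tendsto (fun n : ℕ => Real.log (Zn A φ n a).toReal / n) atTop (nhds P)

/-- `φ` is recurrent (with Gurevich pressure `P`). -/
def Recurrent (A : ℕ → ℕ → Bool) (φ : Space A → ℝ) (P : ℝ) : Prop :=
  ∀ a : ℕ, (cyl A [a]).Nonempty →
    ∑' n : ℕ, ENNReal.ofReal (Real.exp (-((n + 1 : ℕ) : ℝ) * P)) * Zn A φ (n + 1) a = ⊤

/-- `φ` is positive recurrent (with Gurevich pressure `P`). -/
def PosRecurrent (A : ℕ → ℕ → Bool) (φ : Space A → ℝ) (P : ℝ) : Prop :=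
  Recurrent A φ P ∧
  ∀ a : ℕ, (cyl A [a]).Nonempty →
    ∑' n : ℕ, ((n + 1 : ℕ) : ℝ≥0∞) *
      ENNReal.ofReal (Real.exp (-((n + 1 : ℕ) : ℝ) * P)) * Znstar A φ (n + 1) a ≠ ⊤

/-- `φ` is transient (with Gurevich pressure `P`). -/
def Transient (A : ℕ → ℕ → Bool) (φ : Space A → ℝ) (P : ℝ) : Prop :=
  ∀ a : ℕ, (cyl A [a]).Nonempty →
    ∑' n : ℕ, ENNReal.ofReal (Real.exp (-((n + 1 : ℕ) : ℝ) * P)) * Zn A φ (n + 1) a ≠ ⊤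

/-- `Σ_A` is topologically mixing. -/
def TopMixing (A : ℕ → ℕ → Bool) : Prop :=
  ∀ a b : ℕ, ∃ N : ℕ, ∀ n, N < n → ∃ x : Space A, x.1 0 = a ∧ (shift^[n] x).1 0 = b

/-- The big images and preimages (BIP) property. -/
def BIP (A : ℕ → ℕ → Bool) : Prop :=
  ∃ (N : ℕ) (b : Fin N → ℕ), ∀ a : ℕ,
    (∃ i, A (b i) a = true) ∧ (∃ j, A a (b j) = true)

/-- An admissible word. -/
def AdmWord (A : ℕ → ℕ → Bool) (w : List ℕ) : Prop :=
  ∀ (i : ℕ) (h : i + 1 < w.length),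
    A (w.get ⟨i, Nat.lt_of_succ_lt h⟩) (w.get ⟨i + 1, h⟩) = true

/-- The image of `E ⊆ [a̲]` under the cylinder-swapping map `v_{a̲,b̲}`. -/
def swapImage (A : ℕ → ℕ → Bool) (b : List ℕ) (E : Set (Space A)) : Set (Space A) :=
  {y | ∃ x ∈ E, y.1 = concatSeq b ((shift^[b.length] x).1)}

/-- The image of `E` under the prepending map `I_b`. -/
def prepImage (A : ℕ → ℕ → Bool) (b : ℕ) (E : Set (Space A)) : Set (Space A) :=
  {y | ∃ x ∈ E, y.1 = prependSeq b x.1}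

/-- The transition matrix of the renewal shift:
`A(1,1) = A(1,i) = A(i,i-1) = 1` (for `i > 1`), all other entries `0`. -/
def renA : ℕ → ℕ → Bool := fun i j => decide ((i = 1 ∧ 1 ≤ j) ∨ (2 ≤ i ∧ j = i - 1))

/-- The transition matrix of the shift `Σ_{𝓡⁻}`:
`A(i,i+1) = A(i,1) = 1` for `i ≥ 1`, all other entries `0`. -/
def rminusA : ℕ → ℕ → Bool := fun i j => decide (1 ≤ i ∧ (j = i + 1 ∨ j = 1))

/-- The periodic sequence obtained by repeating the word `w`. -/
def perSeq (w : List ℕ) : ℕ → ℕ := fun i => w.getD (i % w.length) 0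

/-- The word `(j, j-1, …, 1, n, n-1, …, j+1)`. -/
def gammaWord (j n : ℕ) : List ℕ :=
  ((List.range j).map (· + 1)).reverse ++ ((List.range (n - j)).map (· + (j + 1))).reverse

/-- The point `x̄ = (1, 2, 3, …)` of `Σ_{𝓡⁻}`. -/
def xbar : Space rminusA := ⟨fun i => i + 1, by intro i; simp [rminusA]⟩

theorem shift_iterate_apply {A : ℕ → ℕ → Bool} (n : ℕ) (x : Space A) (i : ℕ) :
    (shift^[n] x).1 i = x.1 (i + n) := by
  induction n generalizing x with
  | zero => rfl
  | succ n ih =>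
    rw [Function.iterate_succ_apply, ih]
    rfl

theorem measurable_shift {A : ℕ → ℕ → Bool} : Measurable (shift : Space A → Space A) :=
  Measurable.subtype_mk (f := fun (x : Space A) i => x.1 (i + 1)) <|
    measurable_pi_lambda _ fun i => (measurable_pi_apply (i + 1)).comp measurable_subtype_coe

theorem shiftSigma_le (A : ℕ → ℕ → Bool) (n : ℕ) :
    shiftSigma A n ≤ (inferInstance : MeasurableSpace (Space A)) :=
  (measurable_shift.iterate n).comap_le

theorem compatible_of_isFiniteMeasure (A : ℕ → ℕ → Bool) (ν : Measure (Space A))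
    [IsFiniteMeasure ν] (m : MeasurableSpace (Space A)) : Compatible A ν m :=
  ⟨fun _ => Set.univ, fun _ => MeasurableSet.univ, fun _ => measure_ne_top ν _, Set.iUnion_const _⟩

/-- Under a Dirac mass, conditioning does not change the value at the atom. -/
theorem condExp_dirac_self {α : Type*} {m m₀ : MeasurableSpace α} [MeasurableSingletonClass α]
    (hm : m ≤ m₀) (a : α) (f : α → ℝ) :
    ((Measure.dirac a)[f|m]) a = f a := by
  have h := integral_condExp (μ := Measure.dirac a) (f := f) hm
  rwa [integral_dirac, integral_dirac] at h

/-- `x ∈ [w]` exactly when replacing the first `|w|` letters of `x` by `w` gives `x` back. -/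
theorem mem_cyl_iff_concatSeq_eq {A : ℕ → ℕ → Bool} (w : List ℕ) (x : Space A) :
    x ∈ cyl A w ↔ concatSeq w (shift^[w.length] x).1 = x.1 := by
  constructor
  · intro hx
    funext i
    unfold concatSeq
    split_ifs with hi
    · exact (hx ⟨i, hi⟩).symm
    · rw [shift_iterate_apply, Nat.sub_add_cancel (not_lt.mp hi)]
  · intro h i
    rw [← h]
    simp [concatSeq]

theorem shift_iterate_mk_concatSeq {A : ℕ → ℕ → Bool} (w : List ℕ) (x : Space A)
    (h : IsAdm A (concatSeq w (shift^[w.length] x).1)) :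
    shift^[w.length] (⟨_, h⟩ : Space A) = shift^[w.length] x := by
  apply Subtype.ext
  funext i
  rw [shift_iterate_apply]
  simp [concatSeq]

/-- If `x` is determined by its `n`-th shift, the DLR denominator at `x` has one term. -/
theorem dlrDen_of_unique {A : ℕ → ℕ → Bool} (φ : Space A → ℝ) {n : ℕ} {x : Space A}
    (hx : ∀ y : Space A, shift^[n] y = shift^[n] x → y = x) :
    dlrDen A φ n x = Real.exp (birkhoff φ n x) := by
  unfold dlrDen
  exact tsum_eq_single (⟨x, rfl⟩ : {y : Space A // shift^[n] y = shift^[n] x})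
    fun y hy => absurd (Subtype.ext (hx y.1 y.2)) hy

/-- If `x` is determined by its `|w|`-th shift, the DLR kernel at `x` is the indicator of `[w]`. -/
theorem dlrNum_div_dlrDen_of_unique {A : ℕ → ℕ → Bool} (φ : Space A → ℝ) (w : List ℕ)
    {x : Space A} (hx : ∀ y : Space A, shift^[w.length] y = shift^[w.length] x → y = x) :
    dlrNum A φ w x / dlrDen A φ w.length x
      = Set.indicator (cyl A w) (fun _ => (1 : ℝ)) x := by
  rw [dlrDen_of_unique φ hx]
  unfold dlrNum
  split_ifs with h
  · have hz := hx _ (shift_iterate_mk_concatSeq w x h)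
    rw [hz, div_self (Real.exp_ne_zero _), Set.indicator_of_mem]
    exact (mem_cyl_iff_concatSeq_eq w x).2 (congrArg Subtype.val hz)
  · rw [zero_div, Set.indicator_of_notMem]
    intro hmem
    exact h ((mem_cyl_iff_concatSeq_eq w x).1 hmem ▸ x.2)

/-- A Dirac mass at a point determined by each of its shifts is DLR for every potential. -/
theorem isDLR_dirac_of_unique {A : ℕ → ℕ → Bool} (φ : Space A → ℝ) {x : Space A}
    (hx : ∀ (n : ℕ) (y : Space A), shift^[n] y = shift^[n] x → y = x) :
    IsDLR A φ (Measure.dirac x) := by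
  intro n _
  refine ⟨compatible_of_isFiniteMeasure A _ _, ?_⟩
  rintro w rfl
  rw [EventuallyEq, ae_dirac_eq, eventually_pure, dlrNum_div_dlrDen_of_unique φ w (hx _)]
  exact condExp_dirac_self (shiftSigma_le A _) x _

theorem eq_xbar_of_shift_iterate_eq (n : ℕ) (y : Space rminusA)
    (h : shift^[n] y = shift^[n] xbar) : y = xbar := by
  induction n with
  | zero => exact h
  | succ n ih =>
    have hy : ∀ i, y.1 (i + (n + 1)) = i + (n + 1) + 1 := fun i => by
      rw [← shift_iterate_apply, h, shift_iterate_apply]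
      rfl
    refine ih (Subtype.ext (funext fun i => ?_))
    rw [shift_iterate_apply, shift_iterate_apply]
    change y.1 (i + n) = i + n + 1
    have hadm := y.2 (i + n)
    have hi := hy i
    rw [← add_assoc] at hi
    simp only [rminusA, hi, decide_eq_true_eq] at hadm
    omega

theorem statement17 (φ : Space rminusA → ℝ) (hφ : Measurable φ) :
    IsProbabilityMeasure (Measure.dirac xbar) ∧ IsDLR rminusA φ (Measure.dirac xbar) := by
  exact ⟨inferInstance, isDLR_dirac_of_unique φ eq_xbar_of_shift_iterate_eq⟩

end CMS
end

section
/- Let Σ_A be the renewal shift and φ : Σ_A → ℝ the potential φ(x) := x_0 − x_1. Then every nonzero σ-finite Borel measure ν on Σ_A, finite on every cylinder, satisfying L*_φ ν = 2 ν (i.e., ∫ L_φ f dν = 2 ∫ f dν for every f ∈ L¹(ν)) satisfies ν([a]) = (e/2) ν([a−1]) for every a ≥ 2, and consequently ν(Σ_A) = ∞. -/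
open MeasureTheory Filter Topology ENNReal

namespace CMS

theorem cyl_singleton (A : ℕ → ℕ → Bool) (a : ℕ) : cyl A [a] = {x | x.1 0 = a} := by
  ext x
  simp [cyl]

theorem measurableSet_cyl_singleton (A : ℕ → ℕ → Bool) (a : ℕ) :
    MeasurableSet (cyl A [a]) := by
  rw [cyl_singleton]
  have hm : Measurable fun x : Space A => x.1 0 :=
    (measurable_pi_apply 0).comp measurable_subtype_coe
  exact hm (measurableSet_singleton a)

theorem prep_zero {A : ℕ → ℕ → Bool} {a : ℕ} {x : Space A} (h : A a (x.1 0) = true) :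
    (prep A a x).1 0 = a := by
  simp [prep, h, prependSeq]

theorem prep_one {A : ℕ → ℕ → Bool} {a : ℕ} {x : Space A} (h : A a (x.1 0) = true) :
    (prep A a x).1 1 = x.1 0 := by
  simp [prep, h, prependSeq]

/-- The Ruelle operator applied to the indicator of a one-symbol cylinder. -/
theorem ruelle_indicator_cyl_singleton (A : ℕ → ℕ → Bool) (φ : Space A → ℝ) (a : ℕ)
    (x : Space A) :
    ruelle A φ ((cyl A [a]).indicator fun _ => 1) x =
      if A a (x.1 0) = true then Real.exp (φ (prep A a x)) else 0 := by
  rw [ruelle, tsum_eq_single a]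
  · split_ifs with h
    · simp [cyl_singleton, prep_zero h]
    · rfl
  · intro b hb
    split_ifs with h
    · simp [cyl_singleton, prep_zero h, hb]
    · rfl

theorem one_le_apply_zero_of_renA (x : Space renA) : 1 ≤ x.1 0 := by
  have h := x.2 0
  simp only [renA, decide_eq_true_eq] at h
  omega

/-- The Ruelle operator of the renewal shift with potential `x₀ - x₁` maps the indicator
of `[a]` to `e` times the indicator of `[a - 1]`. -/
theorem ruelle_renA_indicator {a : ℕ} (ha : 2 ≤ a) :
    ruelle renA (fun x => ((x.1 0 : ℝ) - (x.1 1 : ℝ))) ((cyl renA [a]).indicator fun _ => 1) =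
      (cyl renA [a - 1]).indicator fun _ => Real.exp 1 := by
  funext x
  have hiff : renA a (x.1 0) = true ↔ x.1 0 = a - 1 := by
    simp only [renA, decide_eq_true_eq]
    omega
  rw [ruelle_indicator_cyl_singleton]
  split_ifs with h
  · have hx := hiff.1 h
    have hcast : ((a : ℝ) - ((a - 1 : ℕ) : ℝ)) = 1 := by
      rw [Nat.cast_sub (by omega)]
      simp
    rw [Set.indicator_of_mem (by simpa [cyl_singleton] using hx), prep_zero h, prep_one h, hx,
      hcast]
  · rw [Set.indicator_of_notMem]
    rw [cyl_singleton]
    exact fun hx => h (hiff.2 hx)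

theorem measure_univ_eq_tsum_cyl (A : ℕ → ℕ → Bool) (ν : Measure (Space A)) :
    ν Set.univ = ∑' a : ℕ, ν (cyl A [a]) := by
  rw [← measure_iUnion _ (measurableSet_cyl_singleton A)]
  · congr 1
    ext x
    simp [cyl_singleton]
  · intro a b hab
    refine Set.disjoint_left.2 fun x hx hy => hab ?_
    simp only [cyl_singleton, Set.mem_ofPred_eq] at hx hy
    exact hx.symm.trans hy

theorem statement19 (ν : Measure (Space renA)) (hν0 : ν ≠ 0) (hsf : SigmaFinite ν)
    (hcyl : ∀ w : List ℕ, w ≠ [] → ν (cyl renA w) ≠ ⊤)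
    (heig : DualEigen renA (fun x => ((x.1 0 : ℝ) - (x.1 1 : ℝ))) 2 ν) :
    (∀ a : ℕ, 2 ≤ a →
      ν (cyl renA [a]) = ENNReal.ofReal (Real.exp 1 / 2) * ν (cyl renA [a - 1])) ∧
    ν Set.univ = ⊤ := by
  have hrec : ∀ a : ℕ, 2 ≤ a →
      ν (cyl renA [a]) = ENNReal.ofReal (Real.exp 1 / 2) * ν (cyl renA [a - 1]) := by
    intro a ha
    have hfin : ∀ b : ℕ, ν (cyl renA [b]) ≠ ⊤ := fun b => hcyl [b] (by simp)
    have hm := measurableSet_cyl_singleton renA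
    have h := heig ((cyl renA [a]).indicator fun _ => 1)
      ((integrable_indicator_iff (hm a)).2 (integrableOn_const (hfin a)))
    rw [ruelle_renA_indicator ha, integral_indicator_const _ (hm _),
      integral_indicator_const _ (hm _), smul_eq_mul, smul_eq_mul, mul_one,
      Measure.real, Measure.real] at h
    rw [← ENNReal.toReal_eq_toReal_iff' (hfin a)
        (ENNReal.mul_ne_top ENNReal.ofReal_ne_top (hfin _)),
      ENNReal.toReal_mul, ENNReal.toReal_ofReal (by positivity)]
    linarith
  refine ⟨hrec, ?_⟩
  have hzero : ν (cyl renA [0]) = 0 := by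
    have hempty : cyl renA [0] = ∅ := by
      rw [cyl_singleton]
      refine Set.eq_empty_of_forall_notMem fun x (hx : x.1 0 = 0) => ?_
      have := one_le_apply_zero_of_renA x
      omega
    rw [hempty, measure_empty]
  have hone : ν (cyl renA [1]) ≠ 0 := by
    intro h1
    have hsucc : ∀ n : ℕ, ν (cyl renA [n + 1]) = 0 := by
      intro n
      induction n with
      | zero => exact h1
      | succ n ih => rw [hrec (n + 1 + 1) (by omega), Nat.add_sub_cancel, ih, mul_zero]
    apply hν0
    rw [← Measure.measure_univ_eq_zero, measure_univ_eq_tsum_cyl, ENNReal.tsum_eq_zero]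
    rintro (_ | n)
    exacts [hzero, hsucc n]
  have hle : ∀ n : ℕ, ν (cyl renA [1]) ≤ ν (cyl renA [n + 1]) := by
    intro n
    induction n with
    | zero => exact le_rfl
    | succ n ih =>
      rw [hrec (n + 1 + 1) (by omega), Nat.add_sub_cancel]
      refine ih.trans (le_mul_of_one_le_left' ?_)
      rw [ENNReal.one_le_ofReal]
      linarith [Real.add_one_le_exp 1]
  rw [measure_univ_eq_tsum_cyl, eq_top_iff,
    ← ENNReal.tsum_const_eq_top_of_ne_zero (α := ℕ) hone]
  exact (ENNReal.tsum_le_tsum hle).trans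
    (ENNReal.tsum_comp_le_tsum_of_injective Nat.succ_injective fun a => ν (cyl renA [a]))

end CMS
end
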